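/- Let G = H ≀ ℤ be the restricted wreath product of a group H with ℤ, with base A. If g ∈ G \ A (i.e., g has nonzero ℤ-component), then the centralizer C_G(g) is an infinite cyclic group. -/

import Mathlib

open Function

variable (H : Type*) [Group H]

/-- The base of the restricted wreath product `H ≀ ℤ`: finitely supported functions `ℤ → H`. -/
def RWBase : Subgroup (ℤ → H) where
  carrier := {f | (mulSupport f).Finite}
  one_mem' := by simp [mulSupport_one]
  mul_mem' := fun hf hg => ((hf.union hg).subset (mulSupport_mul _ _))
  inv_mem' := fun hf => by simpa [mulSupport_inv] using hf

/-- The shift automorphism of the base. -/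
def shiftAut (k : ℤ) : MulAut (RWBase H) where
  toFun f := ⟨fun i => (f : ℤ → H) (i - k), by
    have h : (mulSupport fun i => (f : ℤ → H) (i - k)) =
        (fun i : ℤ => i - k) ⁻¹' mulSupport (f : ℤ → H) := rfl
    show (mulSupport fun i => (f : ℤ → H) (i - k)).Finite
    rw [h]
    exact f.2.preimage (Function.Injective.injOn (f := fun i : ℤ => i - k) fun a b hab => by simpa using hab)⟩
  invFun f := ⟨fun i => (f : ℤ → H) (i + k), by
    have h : (mulSupport fun i => (f : ℤ → H) (i + k)) =
        (fun i : ℤ => i + k) ⁻¹' mulSupport (f : ℤ → H) := rfl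
    show (mulSupport fun i => (f : ℤ → H) (i + k)).Finite
    rw [h]
    exact f.2.preimage (Function.Injective.injOn (f := fun i : ℤ => i + k) fun a b hab => by simpa using hab)⟩
  left_inv f := Subtype.ext (funext fun i => by simp)
  right_inv f := Subtype.ext (funext fun i => by simp)
  map_mul' f g := rfl

/-- The action of `ℤ` on the base by shifting. -/
def shiftHom : Multiplicative ℤ →* MulAut (RWBase H) where
  toFun k := shiftAut H (Multiplicative.toAdd k)
  map_one' := MulEquiv.ext fun f => Subtype.ext (funext fun i => by simp [shiftAut])
  map_mul' k l := MulEquiv.ext fun f => Subtype.ext (funext fun i => by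
    simp [shiftAut, sub_sub])

/-- The restricted wreath product `H ≀ ℤ`. -/
abbrev WreathZ := RWBase H ⋊[shiftHom H] Multiplicative ℤ

/-- The base subgroup `A` of `H ≀ ℤ`. -/
def wreathBase : Subgroup (WreathZ H) := (SemidirectProduct.inl (φ := shiftHom H)).range

/-- The generator `t` of the head `ℤ`. -/
def tGen : WreathZ H := SemidirectProduct.inr (Multiplicative.ofAdd 1)

/-- The element of the base supported at `0` with value `h`. -/
def single0 (h : H) : RWBase H :=
  ⟨fun i => if i = 0 then h else 1, by
    refine Set.Finite.subset (Set.finite_singleton (0 : ℤ)) fun i hi => ?_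
    rw [mem_mulSupport] at hi
    by_contra h0
    exact hi (if_neg h0)⟩

/-- The inclusion of `H` as the copy at coordinate `0`. -/
def incl0 (h : H) : WreathZ H := SemidirectProduct.inl (single0 H h)

theorem base_commute_eq_one {H : Type*} [Group H] (g c : WreathZ H)
    (hg : Multiplicative.toAdd g.right ≠ 0) (hc : c.right = 1) (hcomm : g * c = c * g) :
    c = 1 := by
  have hl := congrArg SemidirectProduct.left hcomm
  simp only [SemidirectProduct.mul_left, hc, map_one, MulAut.one_apply] at hl
  have key : ∀ i : ℤ, (g.left : ℤ → H) i * (c.left : ℤ → H) (i - Multiplicative.toAdd g.right)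
      = (c.left : ℤ → H) i * (g.left : ℤ → H) i :=
    fun i => congrFun (congrArg Subtype.val hl) i
  have step : ∀ i : ℤ, (c.left : ℤ → H) (i - Multiplicative.toAdd g.right) = 1 →
      (c.left : ℤ → H) i = 1 := by
    intro i hi
    have h := key i
    rw [hi, mul_one] at h
    exact (mul_eq_right.mp h.symm)
  have hne : ∀ i : ℤ, (c.left : ℤ → H) i = 1 := by
    intro i
    by_contra hi
    have all : ∀ n : ℕ, (c.left : ℤ → H) (i - n * Multiplicative.toAdd g.right) ≠ 1 := by
      intro n
      induction n with
      | zero => simpa using hi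
      | succ n ih =>
        intro h
        apply ih
        apply step
        rw [← h]
        push_cast
        ring_nf
    refine Set.infinite_of_injective_forall_mem
      (f := fun n : ℕ => i - n * Multiplicative.toAdd g.right) ?_ all c.left.2
    intro a b hab
    have h1 : (a : ℤ) * Multiplicative.toAdd g.right = b * Multiplicative.toAdd g.right := by
      simpa using hab
    exact_mod_cast mul_right_cancel₀ hg h1
  exact SemidirectProduct.ext (Subtype.ext (funext hne)) hc

/-- If `g ∈ G \ A`, i.e. `g` has nonzero `ℤ`-component, then the centralizer of
`g` in `G = H ≀ ℤ` is an infinite cyclic group. -/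
theorem centralizer_infinite_cyclic {H : Type*} [Group H]
    (g : WreathZ H) (hg : g ∉ wreathBase H) :
    (∃ x : WreathZ H, Subgroup.centralizer {g} = Subgroup.zpowers x) ∧
      Infinite (Subgroup.centralizer {g} : Subgroup (WreathZ H)) := by
  have hk : Multiplicative.toAdd g.right ≠ 0 := by
    intro h
    apply hg
    refine ⟨g.left, SemidirectProduct.ext rfl ?_⟩
    exact (toAdd_eq_zero.mp h).symm
  let f : (Subgroup.centralizer {g} : Subgroup (WreathZ H)) →* Multiplicative ℤ :=
    SemidirectProduct.rightHom.comp (Subgroup.subtype _)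
  have hf : Injective f := by
    rw [injective_iff_map_eq_one]
    intro c hc
    exact Subtype.ext (base_commute_eq_one g c.1 hk hc
      (Subgroup.mem_centralizer_singleton_iff.mp c.2).symm)
  constructor
  · have hcyc := isCyclic_of_injective f hf
    obtain ⟨x, hx⟩ := (Subgroup.isCyclic_iff_exists_zpowers_eq_top _).mp hcyc
    exact ⟨x, hx.symm⟩
  · let g' : (Subgroup.centralizer {g} : Subgroup (WreathZ H)) :=
      ⟨g, Subgroup.mem_centralizer_singleton_iff.mpr rfl⟩
    refine Infinite.of_injective (fun n : ℤ => g' ^ n) ?_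
    intro a b hab
    have h := congrArg (fun y => Multiplicative.toAdd (f y)) hab
    simp only [map_zpow, toAdd_zpow, smul_eq_mul] at h
    exact mul_right_cancel₀ (show Multiplicative.toAdd (f g') ≠ 0 from hk) h
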